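/- arXiv:1308.4793 — 5 statements merged into one kernel-verified Lean document; each statement's English description precedes it below -/
import Mathlib

section
/- There exists a Steiner triple system of order 99 admitting a strict 4-bicoloring, that is, a partition of its 99 points into 4 nonempty color classes such that every block intersects exactly two of the classes. -/
/-- `(V, B)` is a Steiner triple system: every block is a 3-element subset of `V`,
and every pair of distinct points of `V` lies in exactly one block. -/
def IsSTS (V : Finset ℕ) (B : Finset (Finset ℕ)) : Prop :=
  (∀ b ∈ B, b.card = 3 ∧ b ⊆ V) ∧
  ∀ x ∈ V, ∀ y ∈ V, x ≠ y → ∃! b, b ∈ B ∧ x ∈ b ∧ y ∈ b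

/-- Blocks through `7 * p` of a 3-bicoloured STS(49) on seven copies of `ZMod 7`, invariant under
simultaneous translation: `{7 * p, 7 * q + d, e}` is a block, where `e` is the entry at `p`, `q`, `d`. -/
def sts49Table : List (List (List ℕ)) :=
  [[[0, 21, 24, 26, 23, 22, 27],
    [25, 28, 30, 29, 33, 35, 31],
    [32, 34, 36, 38, 37, 41, 42],
    [1, 5, 4, 2, 7, 3, 6],
    [8, 10, 9, 13, 14, 11, 15],
    [12, 16, 18, 17, 40, 39, 19],
    [20, 45, 48, 43, 47, 46, 44]],
   [[25, 32, 37, 29, 33, 28, 34],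
    [0, 21, 24, 26, 23, 22, 27],
    [30, 38, 31, 35, 42, 44, 48],
    [8, 12, 11, 9, 0, 10, 13],
    [5, 3, 14, 16, 1, 4, 6],
    [17, 46, 2, 15, 43, 45, 47],
    [18, 39, 19, 40, 36, 41, 20]],
   [[32, 43, 36, 40, 35, 41, 33],
    [30, 42, 46, 45, 39, 29, 37],
    [0, 21, 24, 44, 48, 22, 27],
    [15, 19, 25, 16, 23, 28, 20],
    [26, 12, 7, 34, 0, 6, 31],
    [4, 2, 13, 47, 11, 3, 5],
    [8, 1, 17, 10, 9, 38, 18]],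
   [[1, 0, 5, 10, 6, 2, 4],
    [8, 7, 12, 3, 13, 9, 11],
    [15, 14, 30, 26, 20, 23, 18],
    [0, 35, 19, 36, 40, 17, 41],
    [37, 43, 16, 48, 44, 46, 42],
    [22, 24, 28, 45, 47, 25, 27],
    [34, 29, 32, 38, 33, 39, 31]],
   [[8, 16, 13, 17, 10, 7, 9],
    [5, 0, 6, 4, 20, 19, 2],
    [26, 32, 1, 3, 31, 12, 11],
    [37, 43, 48, 47, 45, 14, 42],
    [0, 40, 46, 18, 15, 44, 39],
    [38, 41, 21, 35, 34, 29, 36],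
    [27, 22, 33, 25, 30, 24, 23]],
   [[12, 20, 41, 36, 14, 16, 15],
    [17, 48, 47, 46, 19, 0, 45],
    [4, 6, 5, 7, 44, 11, 1],
    [22, 21, 27, 43, 42, 33, 23],
    [38, 37, 31, 30, 39, 26, 40],
    [0, 3, 29, 28, 32, 34, 2],
    [25, 24, 18, 13, 10, 9, 8]],
   [[20, 45, 48, 43, 47, 46, 44],
    [18, 14, 36, 39, 37, 17, 38],
    [8, 19, 40, 12, 7, 15, 0],
    [34, 32, 41, 29, 35, 30, 28],
    [27, 24, 26, 33, 22, 31, 21],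
    [25, 9, 11, 13, 10, 16, 23],
    [0, 3, 6, 1, 5, 4, 2]]]

/-- The third point of the block through `x` and `y` in the STS(49) given by `sts49Table`. -/
def sts49Third (x y : ℕ) : ℕ :=
  let e := (((sts49Table.getD (x / 7) []).getD (y / 7) []).getD ((y % 7 + 7 - x % 7) % 7) 0)
  e / 7 * 7 + (e % 7 + x % 7) % 7

/-- The third point of the block through `x` and `y` in an STS(99) that doubles the STS(49):
the points `49, …, 97` are a copy of `ZMod 49`, the point `98` plays the role of `∞`, and the
`i`-th one-factor consists of `{∞, i}` and the pairs with sum `2 * i`. -/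
def sts99Third (x y : ℕ) : ℕ :=
  if x < 49 then
    if y < 49 then sts49Third x y
    else if y = 98 then 49 + x
    else if y = 49 + x then 98
    else 49 + (2 * x + 98 - y) % 49
  else if y < 49 then
    if x = 98 then 49 + y
    else if x = 49 + y then 98
    else 49 + (2 * y + 98 - x) % 49
  else if x = 98 then y - 49
  else if y = 98 then x - 49
  else (x + y - 98) * 25 % 49

/-- The blocks `{x, y, t x y}` of a third-point operation `t` on `V`. -/
def blocksOfThird (V : Finset ℕ) (t : ℕ → ℕ → ℕ) : Finset (Finset ℕ) :=
  V.offDiag.image fun p => {p.1, p.2, t p.1 p.2}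

theorem isSTS_blocksOfThird {V : Finset ℕ} {t : ℕ → ℕ → ℕ}
    (h : ∀ x ∈ V, ∀ y ∈ V, x ≠ y →
      t x y ∈ V ∧ t x y ≠ x ∧ t x y ≠ y ∧ t y x = t x y ∧ t x (t x y) = y) :
    IsSTS V (blocksOfThird V t) := by
  constructor
  · intro b hb
    simp only [blocksOfThird, Finset.mem_image, Finset.mem_offDiag] at hb
    obtain ⟨⟨x, y⟩, ⟨hx, hy, hxy⟩, rfl⟩ := hb
    obtain ⟨hV, h1, h2, -, -⟩ := h x hx y hy hxy
    refine ⟨Finset.card_eq_three.2 ⟨x, y, t x y, hxy, h1.symm, h2.symm, rfl⟩, ?_⟩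
    simp_all [Finset.insert_subset_iff]
  · intro x hx y hy hxy
    refine ⟨{x, y, t x y}, ⟨?_, by simp, by simp⟩, ?_⟩
    · exact Finset.mem_image.2 ⟨(x, y), Finset.mem_offDiag.2 ⟨hx, hy, hxy⟩, rfl⟩
    · rintro b ⟨hb, hxb, hyb⟩
      simp only [blocksOfThird, Finset.mem_image, Finset.mem_offDiag] at hb
      obtain ⟨⟨u, v⟩, ⟨hu, hv, huv⟩, rfl⟩ := hb
      obtain ⟨hV, h1, h2, h3, h4⟩ := h u hu v hv huv
      obtain ⟨-, -, -, h5, h6⟩ := h v hv u hu huv.symm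
      have h7 := (h u hu _ hV h1.symm).2.2.2.1
      have h8 := (h v hv _ hV h2.symm).2.2.2.1
      rw [h3] at h6
      simp only [Finset.mem_insert, Finset.mem_singleton] at hxb hyb
      ext z
      simp only [Finset.mem_insert, Finset.mem_singleton]
      rcases hxb with rfl | rfl | rfl <;> rcases hyb with rfl | rfl | rfl <;> grind

theorem sts99Third_spec : ∀ x < 99, ∀ y < 99, x ≠ y →
    sts99Third x y < 99 ∧ sts99Third x y ≠ x ∧ sts99Third x y ≠ y ∧
      sts99Third y x = sts99Third x y ∧ sts99Third x (sts99Third x y) = y := by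
  decide +kernel

theorem sts99Third_bicolored : ∀ x < 99, ∀ y < 99, x ≠ y →
    (((if x < 21 ∨ y < 21 ∨ sts99Third x y < 21 then 1 else 0) +
      (if (21 ≤ x ∧ x < 35) ∨ (21 ≤ y ∧ y < 35) ∨
        (21 ≤ sts99Third x y ∧ sts99Third x y < 35) then 1 else 0) +
      (if (35 ≤ x ∧ x < 49) ∨ (35 ≤ y ∧ y < 49) ∨
        (35 ≤ sts99Third x y ∧ sts99Third x y < 49) then 1 else 0) +
      (if (49 ≤ x ∧ x < 99) ∨ (49 ≤ y ∧ y < 99) ∨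
        (49 ≤ sts99Third x y ∧ sts99Third x y < 99) then 1 else 0) : ℕ) = 2) := by
  decide +kernel

theorem triple_inter_nonempty_iff {α : Type*} [DecidableEq α] (x y z : α) (X : Finset α) :
    (({x, y, z} : Finset α) ∩ X).Nonempty ↔ x ∈ X ∨ y ∈ X ∨ z ∈ X := by
  simp [Finset.Nonempty, or_and_right, exists_or]

theorem stmt_14 :
    ∃ (V : Finset ℕ) (B : Finset (Finset ℕ)),
      V.card = 99 ∧ IsSTS V B ∧
      ∃ X1 X2 X3 X4 : Finset ℕ,
        X1.Nonempty ∧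
        X2.Nonempty ∧
        X3.Nonempty ∧
        X4.Nonempty ∧
        Disjoint X1 X2 ∧
        Disjoint X1 X3 ∧
        Disjoint X1 X4 ∧
        Disjoint X2 X3 ∧
        Disjoint X2 X4 ∧
        Disjoint X3 X4 ∧
        X1 ∪ X2 ∪ X3 ∪ X4 = V ∧
        ∀ b ∈ B,
          (((if (b ∩ X1).Nonempty then 1 else 0) +
           (if (b ∩ X2).Nonempty then 1 else 0) +
           (if (b ∩ X3).Nonempty then 1 else 0) +
           (if (b ∩ X4).Nonempty then 1 else 0) : ℕ) = 2) := by
  refine ⟨Finset.range 99, blocksOfThird (Finset.range 99) sts99Third, by simp,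
    isSTS_blocksOfThird (by simpa only [Finset.mem_range] using sts99Third_spec),
    Finset.range 21, Finset.Ico 21 35, Finset.Ico 35 49, Finset.Ico 49 99,
    by simp, by simp, by simp, by simp,
    by decide, by decide, by decide, by decide, by decide, by decide,
    by ext; simp only [Finset.mem_union, Finset.mem_range, Finset.mem_Ico]; omega, ?_⟩
  intro b hb
  simp only [blocksOfThird, Finset.mem_image, Finset.mem_offDiag, Finset.mem_range] at hb
  obtain ⟨⟨x, y⟩, ⟨hx, hy, hxy⟩, rfl⟩ := hb
  simpa only [triple_inter_nonempty_iff, Finset.mem_range, Finset.mem_Ico] using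
    sts99Third_bicolored x hx y hy hxy
end

section
/- There exists a Steiner triple system of order 99 admitting a strict 5-bicoloring, that is, a partition of its 99 points into 5 nonempty color classes such that every block intersects exactly two of the classes. -/
/-- `f` sends two distinct points below `n` to the third point of a block through them. -/
def IsThirdPoint (n : ℕ) (f : ℕ → ℕ → ℕ) : Prop :=
  ∀ x < n, ∀ y < n, x ≠ y →
    f x y < n ∧ f x y ≠ x ∧ f x y ≠ y ∧ f y x = f x y ∧ f x (f x y) = y

instance (n : ℕ) (f : ℕ → ℕ → ℕ) : Decidable (IsThirdPoint n f) := by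
  unfold IsThirdPoint; infer_instance

/-- The blocks `{x, y, f x y}` on the points below `n`. -/
def thirdPointBlocks (n : ℕ) (f : ℕ → ℕ → ℕ) : Finset (Finset ℕ) :=
  (Finset.range n).offDiag.image fun p => {p.1, p.2, f p.1 p.2}

theorem mem_thirdPointBlocks {n : ℕ} {f : ℕ → ℕ → ℕ} {b : Finset ℕ} :
    b ∈ thirdPointBlocks n f ↔ ∃ x < n, ∃ y < n, x ≠ y ∧ b = {x, y, f x y} := by
  simp only [thirdPointBlocks, Finset.mem_image, Finset.mem_offDiag, Finset.mem_range,
    Prod.exists]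
  constructor
  · rintro ⟨x, y, ⟨hx, hy, hxy⟩, rfl⟩
    exact ⟨x, hx, y, hy, hxy, rfl⟩
  · rintro ⟨x, hx, y, hy, hxy, rfl⟩
    exact ⟨x, y, ⟨hx, hy, hxy⟩, rfl⟩

/-- A third-point operation is determined on a block by any two of its points. -/
theorem IsThirdPoint.block_eq {n : ℕ} {f : ℕ → ℕ → ℕ} (hf : IsThirdPoint n f)
    {x y a c : ℕ} (ha : a < n) (hc : c < n) (hac : a ≠ c) (hxy : x ≠ y)
    (hx : x ∈ ({a, c, f a c} : Finset ℕ)) (hy : y ∈ ({a, c, f a c} : Finset ℕ)) :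
    ({a, c, f a c} : Finset ℕ) = {x, y, f x y} := by
  obtain ⟨hlt, hne₁, hne₂, hsymm, hinv⟩ := hf a ha c hc hac
  have hinv' : f c (f a c) = a := hsymm ▸ (hf c hc a ha hac.symm).2.2.2.2
  have h₁ : f (f a c) a = c := (hf a ha _ hlt hne₁.symm).2.2.2.1.trans hinv
  have h₂ : f (f a c) c = a := (hf c hc _ hlt hne₂.symm).2.2.2.1.trans hinv'
  simp only [Finset.mem_insert, Finset.mem_singleton] at hx hy
  rcases hx with rfl | rfl | rfl <;> rcases hy with rfl | rfl | rfl <;>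
    first
    | exact absurd rfl hxy
    | (ext w; simp only [Finset.mem_insert, Finset.mem_singleton, hsymm, hinv, hinv', h₁, h₂]
       try tauto)

theorem IsThirdPoint.isSTS {n : ℕ} {f : ℕ → ℕ → ℕ} (hf : IsThirdPoint n f) :
    IsSTS (Finset.range n) (thirdPointBlocks n f) := by
  constructor
  · intro b hb
    obtain ⟨x, hx, y, hy, hxy, rfl⟩ := mem_thirdPointBlocks.1 hb
    obtain ⟨hlt, hne₁, hne₂, -⟩ := hf x hx y hy hxy
    refine ⟨Finset.card_eq_three.2 ⟨x, y, f x y, hxy, hne₁.symm, hne₂.symm, rfl⟩, ?_⟩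
    simp [Finset.insert_subset_iff, hx, hy, hlt]
  · intro x hx y hy hxy
    rw [Finset.mem_range] at hx hy
    refine ⟨{x, y, f x y}, ⟨mem_thirdPointBlocks.2 ⟨x, hx, y, hy, hxy, rfl⟩, by simp, by simp⟩, ?_⟩
    rintro b ⟨hb, hxb, hyb⟩
    obtain ⟨a, ha, c, hc, hac, rfl⟩ := mem_thirdPointBlocks.1 hb
    exact hf.block_eq ha hc hac hxy hxb hyb

/-- Rows of the third-point table of a Steiner triple system of order 49 that is strictly
4-bicolored by the classes `[0, 24)`, `[24, 38)`, `[38, 44)` and `[44, 49)`. -/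
def thirdPointTable : List (List ℕ) :=
  [[0, 46, 32, 38, 45, 34, 39, 24, 26, 29, 44, 35, 37, 41, 40, 28, 43, 48, 42, 47, 27, 31, 30, 25, 7,
    23, 8, 20, 15, 9, 22, 21, 2, 36, 5, 11, 33, 12, 3, 6, 14, 13, 18, 16, 10, 4, 1, 19, 17],
   [46, 1, 38, 40, 36, 31, 25, 41, 37, 48, 42, 30, 47, 45, 44, 24, 35, 34, 39, 33, 32, 29, 43, 26, 15,
    6, 23, 28, 27, 21, 11, 5, 20, 19, 17, 16, 4, 8, 2, 18, 3, 7, 10, 22, 14, 13, 0, 12, 9],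
   [32, 38, 2, 48, 34, 26, 42, 37, 24, 41, 43, 46, 45, 44, 31, 27, 33, 25, 36, 29, 39, 40, 28, 47, 8,
    17, 5, 15, 22, 19, 35, 14, 0, 16, 4, 30, 18, 7, 1, 20, 21, 9, 6, 10, 13, 12, 11, 23, 3],
   [38, 40, 48, 3, 30, 39, 47, 29, 25, 32, 28, 33, 46, 43, 41, 31, 45, 24, 37, 36, 44, 27, 42, 35, 17,
    8, 34, 21, 10, 7, 4, 15, 9, 11, 26, 23, 19, 18, 0, 5, 1, 14, 22, 13, 20, 16, 12, 6, 2],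
   [45, 36, 34, 30, 4, 46, 29, 43, 41, 26, 37, 28, 27, 24, 39, 32, 38, 40, 25, 42, 33, 47, 44, 48, 13,
    18, 9, 12, 11, 6, 3, 35, 15, 20, 2, 31, 1, 10, 16, 14, 17, 8, 19, 7, 22, 0, 5, 21, 23],
   [34, 31, 26, 39, 46, 5, 41, 48, 32, 38, 47, 36, 30, 28, 37, 42, 29, 27, 45, 24, 43, 33, 40, 44, 19,
    35, 2, 17, 13, 16, 12, 1, 8, 21, 0, 25, 11, 14, 9, 3, 22, 6, 15, 20, 23, 18, 4, 10, 7],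
   [39, 25, 42, 47, 29, 41, 6, 28, 48, 33, 32, 37, 38, 35, 45, 44, 40, 46, 30, 43, 24, 34, 36, 31, 20,
    1, 27, 26, 7, 4, 18, 23, 10, 9, 21, 13, 22, 11, 12, 0, 16, 5, 2, 19, 15, 14, 17, 3, 8],
   [24, 41, 37, 29, 43, 48, 28, 7, 38, 27, 35, 42, 40, 30, 47, 26, 39, 44, 33, 46, 34, 45, 25, 32, 0,
    22, 15, 9, 6, 3, 13, 36, 23, 18, 20, 10, 31, 2, 8, 16, 12, 1, 11, 4, 17, 21, 19, 14, 5],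
   [26, 37, 24, 25, 41, 32, 48, 38, 8, 34, 31, 44, 36, 47, 35, 40, 42, 43, 46, 27, 45, 39, 33, 30, 2,
    3, 0, 19, 29, 28, 23, 10, 5, 22, 9, 14, 12, 1, 7, 21, 15, 4, 16, 17, 11, 20, 18, 13, 6],
   [29, 48, 41, 32, 26, 38, 33, 27, 34, 9, 39, 40, 28, 36, 42, 30, 44, 47, 35, 31, 46, 24, 45, 43, 21,
    37, 4, 7, 12, 0, 15, 19, 3, 6, 8, 18, 13, 25, 5, 10, 11, 2, 14, 23, 16, 22, 20, 17, 1],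
   [44, 42, 43, 28, 37, 47, 32, 35, 31, 39, 10, 38, 26, 27, 29, 33, 46, 45, 41, 40, 25, 48, 34, 24, 23,
    20, 12, 13, 3, 14, 36, 8, 6, 15, 22, 7, 30, 4, 11, 9, 19, 18, 1, 2, 0, 17, 16, 5, 21],
   [35, 30, 46, 33, 28, 36, 37, 42, 44, 40, 38, 11, 41, 29, 48, 43, 27, 32, 26, 45, 47, 25, 39, 34, 31,
    21, 18, 16, 4, 13, 1, 24, 17, 3, 23, 0, 5, 6, 10, 22, 9, 12, 7, 15, 8, 19, 2, 20, 14],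
   [37, 47, 45, 46, 27, 30, 38, 40, 36, 28, 26, 41, 12, 48, 34, 39, 32, 29, 44, 25, 42, 43, 31, 33, 35,
    19, 10, 4, 9, 17, 5, 22, 16, 23, 14, 24, 8, 0, 6, 15, 7, 11, 20, 21, 18, 2, 3, 1, 13],
   [41, 45, 44, 43, 24, 28, 35, 30, 47, 36, 27, 29, 48, 13, 33, 37, 26, 38, 32, 34, 40, 42, 46, 39, 4,
    31, 16, 10, 5, 11, 7, 25, 18, 14, 19, 6, 9, 15, 17, 23, 20, 0, 21, 3, 2, 1, 22, 8, 12],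
   [40, 44, 31, 41, 39, 37, 45, 47, 35, 42, 29, 48, 34, 33, 14, 46, 24, 26, 43, 30, 36, 32, 27, 38, 16,
    28, 17, 22, 25, 10, 19, 2, 21, 13, 12, 8, 20, 5, 23, 4, 0, 3, 9, 18, 1, 6, 15, 7, 11],
   [28, 24, 27, 31, 32, 42, 44, 26, 40, 30, 33, 43, 39, 37, 46, 15, 25, 41, 47, 35, 38, 36, 48, 45, 1,
    16, 7, 2, 0, 34, 9, 3, 4, 10, 29, 19, 21, 13, 20, 12, 8, 17, 5, 11, 6, 23, 14, 18, 22],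
   [43, 35, 33, 45, 38, 29, 40, 39, 42, 44, 46, 27, 32, 26, 24, 25, 16, 36, 48, 41, 31, 30, 47, 28, 14,
    15, 13, 11, 23, 5, 21, 20, 12, 2, 37, 1, 17, 34, 4, 7, 6, 19, 8, 0, 9, 3, 10, 22, 18],
   [48, 34, 25, 24, 40, 27, 46, 44, 43, 47, 45, 32, 29, 38, 26, 41, 36, 17, 31, 39, 37, 28, 35, 42, 3,
    2, 14, 5, 21, 12, 33, 18, 11, 30, 1, 22, 16, 20, 13, 19, 4, 15, 23, 8, 7, 10, 6, 9, 0],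
   [42, 39, 36, 37, 25, 45, 30, 33, 46, 35, 41, 26, 44, 32, 43, 47, 48, 31, 18, 28, 29, 38, 24, 40, 22,
    4, 11, 34, 19, 20, 6, 17, 13, 7, 27, 9, 2, 3, 21, 1, 23, 10, 0, 14, 12, 5, 8, 15, 16],
   [47, 33, 29, 36, 42, 24, 43, 46, 27, 31, 40, 45, 25, 34, 30, 35, 41, 39, 28, 19, 48, 44, 38, 37, 5,
    12, 32, 8, 18, 2, 14, 9, 26, 1, 13, 15, 3, 23, 22, 17, 10, 16, 4, 6, 21, 11, 7, 0, 20],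
   [27, 32, 39, 44, 33, 43, 24, 34, 45, 46, 25, 47, 42, 40, 36, 38, 31, 37, 29, 48, 20, 35, 26, 41, 6,
    10, 22, 0, 30, 18, 28, 16, 1, 4, 7, 21, 14, 17, 15, 2, 13, 23, 12, 5, 3, 8, 9, 11, 19],
   [31, 29, 40, 27, 47, 33, 34, 45, 39, 24, 48, 25, 43, 42, 32, 36, 30, 28, 38, 44, 35, 21, 41, 46, 9,
    11, 37, 3, 17, 1, 16, 0, 14, 5, 6, 20, 15, 26, 18, 8, 2, 22, 13, 12, 19, 7, 23, 4, 10],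
   [30, 43, 28, 42, 44, 40, 36, 25, 33, 45, 34, 39, 31, 46, 27, 48, 47, 35, 24, 38, 26, 41, 22, 29, 18,
    7, 20, 14, 2, 23, 0, 12, 37, 8, 10, 17, 6, 32, 19, 11, 5, 21, 3, 1, 4, 9, 13, 16, 15],
   [25, 26, 47, 35, 48, 44, 31, 32, 30, 43, 24, 34, 33, 39, 38, 45, 28, 42, 40, 37, 41, 46, 29, 23, 10,
    0, 1, 36, 16, 22, 8, 6, 7, 12, 11, 3, 27, 19, 14, 13, 18, 20, 17, 9, 5, 15, 21, 2, 4],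
   [7, 15, 8, 17, 13, 19, 20, 0, 2, 21, 23, 31, 35, 4, 16, 1, 14, 3, 22, 5, 6, 9, 18, 10, 24,
    45, 41, 43, 42, 38, 44, 11, 39, 47, 40, 12, 46, 48, 29, 32, 34, 26, 28, 27, 30, 25, 36, 33, 37],
   [23, 6, 17, 8, 18, 35, 1, 22, 3, 37, 20, 21, 19, 31, 28, 16, 15, 2, 4, 12, 10, 11, 7, 0, 45,
    25, 46, 47, 14, 40, 39, 13, 38, 42, 44, 5, 48, 9, 32, 30, 29, 43, 33, 41, 34, 24, 26, 27, 36],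
   [8, 23, 5, 34, 9, 2, 27, 15, 0, 4, 12, 18, 10, 16, 17, 7, 13, 14, 11, 32, 22, 37, 20, 1, 41,
    46, 26, 6, 44, 45, 43, 48, 19, 38, 3, 39, 47, 21, 33, 35, 42, 24, 40, 30, 28, 29, 25, 36, 31],
   [20, 28, 15, 21, 12, 17, 26, 9, 19, 7, 13, 16, 4, 10, 22, 2, 11, 5, 34, 8, 0, 3, 14, 36, 43,
    47, 6, 27, 1, 42, 40, 45, 46, 41, 18, 38, 23, 39, 35, 37, 30, 33, 29, 24, 48, 31, 32, 25, 44],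
   [15, 27, 22, 10, 11, 13, 7, 6, 29, 12, 3, 4, 9, 5, 25, 0, 23, 21, 19, 18, 30, 17, 2, 16, 42,
    14, 44, 1, 28, 8, 20, 43, 48, 46, 45, 47, 38, 40, 36, 41, 37, 39, 24, 31, 26, 34, 33, 35, 32],
   [9, 21, 19, 7, 6, 16, 4, 3, 28, 0, 14, 13, 17, 11, 10, 34, 5, 12, 20, 2, 18, 1, 23, 22, 38,
    40, 45, 42, 8, 29, 41, 46, 43, 44, 15, 48, 39, 47, 24, 36, 25, 30, 27, 32, 33, 26, 31, 37, 35],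
   [22, 11, 35, 4, 3, 12, 18, 13, 23, 15, 36, 1, 5, 7, 19, 9, 21, 33, 6, 14, 28, 16, 0, 8, 44,
    39, 43, 40, 20, 41, 30, 38, 47, 17, 42, 2, 10, 46, 31, 25, 27, 29, 34, 26, 24, 48, 37, 32, 45],
   [21, 5, 14, 15, 35, 1, 23, 36, 10, 19, 8, 24, 22, 25, 2, 3, 20, 18, 17, 9, 16, 0, 12, 6, 11,
    13, 48, 45, 43, 46, 38, 31, 44, 39, 47, 4, 7, 42, 30, 33, 41, 40, 37, 28, 32, 27, 29, 34, 26],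
   [2, 20, 0, 9, 15, 8, 10, 23, 5, 3, 6, 17, 16, 18, 21, 4, 12, 11, 13, 26, 1, 14, 37, 7, 39,
    38, 19, 46, 48, 43, 47, 44, 32, 40, 41, 45, 42, 22, 25, 24, 33, 34, 36, 29, 31, 35, 27, 30, 28],
   [36, 19, 16, 11, 20, 21, 9, 18, 22, 6, 15, 3, 23, 14, 13, 10, 2, 30, 7, 1, 4, 5, 8, 12, 47,
    42, 38, 41, 46, 44, 17, 39, 40, 33, 48, 43, 0, 45, 26, 31, 32, 27, 25, 35, 29, 37, 28, 24, 34],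
   [5, 17, 4, 26, 2, 0, 21, 20, 9, 8, 22, 23, 14, 19, 12, 29, 37, 1, 27, 13, 7, 6, 10, 11, 40,
    44, 3, 18, 45, 15, 42, 47, 41, 48, 34, 46, 43, 16, 39, 38, 24, 32, 30, 36, 25, 28, 35, 31, 33],
   [11, 16, 30, 23, 31, 25, 13, 10, 14, 18, 7, 0, 24, 6, 8, 19, 1, 22, 9, 15, 21, 20, 17, 3, 12,
    5, 39, 38, 47, 48, 2, 4, 45, 43, 46, 35, 40, 44, 27, 26, 36, 42, 41, 33, 37, 32, 34, 28, 29],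
   [33, 4, 18, 19, 1, 11, 22, 31, 12, 13, 30, 5, 8, 9, 20, 21, 17, 16, 2, 3, 14, 15, 6, 27, 46,
    48, 47, 23, 38, 39, 10, 7, 42, 0, 43, 40, 36, 41, 28, 29, 35, 37, 32, 34, 45, 44, 24, 26, 25],
   [12, 8, 7, 18, 10, 14, 11, 2, 1, 25, 4, 6, 0, 15, 5, 13, 34, 20, 3, 23, 17, 26, 32, 19, 48,
    9, 21, 39, 40, 47, 46, 42, 22, 45, 16, 44, 41, 37, 43, 27, 28, 36, 31, 38, 35, 33, 30, 29, 24],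
   [3, 2, 1, 0, 16, 9, 12, 8, 7, 5, 11, 10, 6, 17, 23, 20, 4, 13, 21, 22, 15, 18, 19, 14, 29,
    32, 33, 35, 36, 24, 31, 30, 25, 26, 39, 27, 28, 43, 38, 34, 45, 48, 46, 37, 47, 40, 42, 44, 41],
   [6, 18, 20, 5, 14, 3, 0, 16, 21, 10, 9, 22, 15, 23, 4, 12, 7, 19, 1, 17, 2, 8, 11, 13, 32,
    30, 35, 37, 41, 36, 25, 33, 24, 31, 38, 26, 29, 27, 34, 39, 48, 28, 44, 47, 42, 46, 45, 43, 40],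
   [14, 3, 21, 1, 17, 22, 16, 12, 15, 11, 19, 9, 7, 20, 0, 8, 6, 4, 23, 10, 13, 2, 5, 18, 34,
    29, 42, 30, 37, 25, 27, 41, 33, 32, 24, 36, 35, 28, 45, 48, 40, 31, 26, 44, 43, 38, 47, 46, 39],
   [13, 7, 9, 14, 8, 6, 5, 1, 4, 2, 18, 12, 11, 0, 3, 17, 19, 15, 10, 16, 23, 22, 21, 20, 26,
    43, 24, 33, 39, 30, 29, 40, 34, 27, 32, 42, 37, 36, 48, 28, 31, 41, 35, 25, 46, 47, 44, 45, 38],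
   [18, 10, 6, 22, 19, 15, 2, 11, 16, 14, 1, 7, 20, 21, 9, 5, 8, 23, 0, 4, 12, 13, 3, 17, 28,
    33, 40, 29, 24, 27, 34, 37, 36, 25, 30, 41, 32, 31, 46, 44, 26, 35, 42, 45, 39, 43, 38, 48, 47],
   [16, 22, 10, 13, 7, 20, 19, 4, 17, 23, 2, 15, 21, 3, 18, 11, 0, 8, 14, 6, 5, 12, 1, 9, 27,
    41, 30, 24, 31, 32, 26, 28, 29, 35, 36, 33, 34, 38, 37, 47, 44, 25, 45, 43, 40, 42, 48, 39, 46],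
   [10, 14, 13, 20, 22, 23, 15, 17, 11, 16, 0, 8, 18, 2, 1, 6, 9, 7, 12, 21, 3, 19, 4, 5, 30,
    34, 28, 48, 26, 33, 24, 32, 31, 29, 25, 37, 45, 35, 47, 42, 43, 46, 39, 40, 44, 36, 41, 38, 27],
   [4, 13, 12, 16, 0, 18, 14, 21, 20, 22, 17, 19, 2, 1, 6, 23, 3, 10, 5, 11, 8, 7, 9, 15, 25,
    24, 29, 31, 34, 26, 48, 27, 35, 37, 28, 32, 44, 33, 40, 46, 38, 47, 43, 42, 36, 45, 39, 41, 30],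
   [1, 0, 11, 12, 5, 4, 17, 19, 18, 20, 16, 2, 3, 22, 15, 14, 10, 6, 8, 7, 9, 23, 13, 21, 36,
    26, 25, 32, 33, 31, 37, 29, 27, 28, 35, 34, 24, 30, 42, 45, 47, 44, 38, 48, 41, 39, 46, 40, 43],
   [19, 12, 23, 6, 21, 10, 3, 14, 13, 17, 5, 20, 1, 8, 7, 18, 22, 9, 15, 0, 11, 4, 16, 2, 33,
    27, 36, 25, 35, 37, 32, 34, 30, 24, 31, 28, 26, 29, 44, 43, 46, 45, 48, 39, 38, 41, 40, 47, 42],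
   [17, 9, 3, 2, 23, 7, 8, 5, 6, 1, 21, 14, 13, 12, 11, 22, 18, 0, 16, 20, 19, 10, 15, 4, 37,
    36, 31, 44, 32, 35, 45, 26, 28, 34, 33, 29, 25, 24, 41, 40, 39, 38, 47, 46, 27, 30, 43, 42, 48]]

/-- The third-point operation on 99 points extending `thirdPointTable`: the points from 49 on
represent `ZMod 49` (shifted by 49) and a point at infinity, 98. Point `i < 49` is joined to the
pairs of the one-factor consisting of `{i, ∞}` and the pairs with sum `2 * i`. -/
def thirdPoint (x y : ℕ) : ℕ :=
  if x < 49 then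
    if y < 49 then (thirdPointTable.getD x []).getD y 0
    else factorPartner x y
  else if y < 49 then factorPartner y x
  else if x = 98 then y - 49
  else if y = 98 then x - 49
  else 25 * (x + y - 98) % 49
where
  /-- The partner of `y` in the one-factor joined to `i`. -/
  factorPartner (i y : ℕ) : ℕ :=
    if y = 98 then i + 49
    else if y = i + 49 then 98
    else (2 * i + 98 - y) % 49 + 49

theorem isThirdPoint_thirdPoint : IsThirdPoint 99 thirdPoint := by
  decide +kernel

/-- The index of the color class of a point. -/
def pointColor (x : ℕ) : ℕ :=
  if x < 24 then 1 else if x < 38 then 2 else if x < 44 then 3 else if x < 49 then 4 else 5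

/-- Every block has exactly two points of one of its colors. -/
theorem pointColor_thirdPoint : ∀ x < 99, ∀ y < 99, x ≠ y →
    (pointColor x = pointColor y ∧ pointColor (thirdPoint x y) ≠ pointColor x) ∨
    (pointColor x ≠ pointColor y ∧ (pointColor (thirdPoint x y) = pointColor x ∨
      pointColor (thirdPoint x y) = pointColor y)) := by
  decide +kernel

/-- The points of color `k`. -/
def colorClass (k : ℕ) : Finset ℕ := (Finset.range 99).filter fun x => pointColor x = k

theorem disjoint_colorClass {j k : ℕ} (h : j ≠ k) : Disjoint (colorClass j) (colorClass k) :=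
  Finset.disjoint_filter.2 fun _ _ hj hk => h (hj.symm.trans hk)

theorem pointColor_mem_Icc (x : ℕ) : pointColor x ∈ Finset.Icc 1 5 := by
  unfold pointColor
  split_ifs <;> decide

theorem inter_colorClass_nonempty {x y z : ℕ} (hx : x < 99) (hy : y < 99) (hz : z < 99) (k : ℕ) :
    (({x, y, z} : Finset ℕ) ∩ colorClass k).Nonempty ↔
      pointColor x = k ∨ pointColor y = k ∨ pointColor z = k := by
  simp [Finset.Nonempty, colorClass, hx, hy, hz]

theorem card_colors_eq_two : ∀ i ∈ Finset.Icc 1 5, ∀ j ∈ Finset.Icc 1 5, ∀ k ∈ Finset.Icc 1 5,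
    ((i = j ∧ k ≠ i) ∨ (i ≠ j ∧ (k = i ∨ k = j))) →
    ((if i = 1 ∨ j = 1 ∨ k = 1 then 1 else 0) + (if i = 2 ∨ j = 2 ∨ k = 2 then 1 else 0) +
      (if i = 3 ∨ j = 3 ∨ k = 3 then 1 else 0) + (if i = 4 ∨ j = 4 ∨ k = 4 then 1 else 0) +
      (if i = 5 ∨ j = 5 ∨ k = 5 then 1 else 0) : ℕ) = 2 := by
  decide +kernel

theorem colorClass_union :
    colorClass 1 ∪ colorClass 2 ∪ colorClass 3 ∪ colorClass 4 ∪ colorClass 5 =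
      Finset.range 99 := by
  ext x
  have := Finset.mem_Icc.1 (pointColor_mem_Icc x)
  simp only [colorClass, Finset.mem_union, Finset.mem_filter, Finset.mem_range]
  omega

theorem stmt_15 :
    ∃ (V : Finset ℕ) (B : Finset (Finset ℕ)),
      V.card = 99 ∧ IsSTS V B ∧
      ∃ X1 X2 X3 X4 X5 : Finset ℕ,
        X1.Nonempty ∧
        X2.Nonempty ∧
        X3.Nonempty ∧
        X4.Nonempty ∧
        X5.Nonempty ∧
        Disjoint X1 X2 ∧
        Disjoint X1 X3 ∧
        Disjoint X1 X4 ∧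
        Disjoint X1 X5 ∧
        Disjoint X2 X3 ∧
        Disjoint X2 X4 ∧
        Disjoint X2 X5 ∧
        Disjoint X3 X4 ∧
        Disjoint X3 X5 ∧
        Disjoint X4 X5 ∧
        X1 ∪ X2 ∪ X3 ∪ X4 ∪ X5 = V ∧
        ∀ b ∈ B,
          (((if (b ∩ X1).Nonempty then 1 else 0) +
           (if (b ∩ X2).Nonempty then 1 else 0) +
           (if (b ∩ X3).Nonempty then 1 else 0) +
           (if (b ∩ X4).Nonempty then 1 else 0) +
           (if (b ∩ X5).Nonempty then 1 else 0) : ℕ) = 2) := by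
  
  refine ⟨Finset.range 99, thirdPointBlocks 99 thirdPoint, Finset.card_range 99,
    isThirdPoint_thirdPoint.isSTS, colorClass 1, colorClass 2, colorClass 3, colorClass 4,
    colorClass 5, ⟨0, by decide⟩, ⟨24, by decide⟩, ⟨38, by decide⟩, ⟨44, by decide⟩,
    ⟨49, by decide⟩, ?_, ?_, ?_, ?_, ?_, ?_, ?_, ?_, ?_, ?_, colorClass_union, ?_⟩
  iterate 10 exact disjoint_colorClass (by decide)
  intro b hb
  obtain ⟨x, hx, y, hy, hxy, rfl⟩ := mem_thirdPointBlocks.1 hb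
  have hz := (isThirdPoint_thirdPoint x hx y hy hxy).1
  have hcol := pointColor_thirdPoint x hx y hy hxy
  simp only [inter_colorClass_nonempty hx hy hz]
  exact card_colors_eq_two _ (pointColor_mem_Icc x) _ (pointColor_mem_Icc y) _
    (pointColor_mem_Icc (thirdPoint x y)) hcol
end

section
/- There exists a Steiner triple system of order 13 admitting a strict 3-bicoloring whose color classes have sizes 2, 5 and 6, that is, a partition of its 13 points into classes of sizes 2, 5 and 6 such that every block intersects exactly two of the classes. -/
/-- The blocks of a Steiner triple system on `{0, …, 12}` that is strictly bicolored by the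
classes `{0, 1}`, `{2, …, 6}` and `{7, …, 12}`. -/
def bicoloredBlocks : Finset (Finset ℕ) :=
  {{0, 1, 2}, {0, 3, 4}, {0, 5, 6}, {0, 7, 8}, {0, 9, 10}, {0, 11, 12}, {1, 3, 5},
    {1, 4, 6}, {1, 7, 9}, {1, 8, 11}, {1, 10, 12}, {2, 3, 7}, {2, 4, 9}, {2, 5, 12},
    {2, 6, 8}, {2, 10, 11}, {3, 6, 10}, {3, 8, 12}, {3, 9, 11}, {4, 5, 11}, {4, 7, 12},
    {4, 8, 10}, {5, 7, 10}, {5, 8, 9}, {6, 7, 11}, {6, 9, 12}}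

theorem isSTS_of_card_filter_eq_one {V : Finset ℕ} {B : Finset (Finset ℕ)}
    (hB : ∀ b ∈ B, b.card = 3 ∧ b ⊆ V)
    (h : ∀ x ∈ V, ∀ y ∈ V, x ≠ y → (B.filter fun b => x ∈ b ∧ y ∈ b).card = 1) :
    IsSTS V B := by
  refine ⟨hB, fun x hx y hy hxy => ?_⟩
  obtain ⟨b, hb⟩ := Finset.card_eq_one.mp (h x hx y hy hxy)
  have mem_iff (c : Finset ℕ) : (c ∈ B ∧ x ∈ c ∧ y ∈ c) ↔ c = b := by
    rw [← Finset.mem_singleton, ← hb, Finset.mem_filter]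
  exact ⟨b, (mem_iff b).mpr rfl, fun c => (mem_iff c).mp⟩

theorem isSTS_bicoloredBlocks : IsSTS (Finset.range 13) bicoloredBlocks :=
  isSTS_of_card_filter_eq_one (by decide +kernel) (by decide +kernel)

theorem stmt_16 :
    ∃ (V : Finset ℕ) (B : Finset (Finset ℕ)),
      V.card = 13 ∧ IsSTS V B ∧
      ∃ X1 X2 X3 : Finset ℕ,
        X1.card = 2 ∧
        X2.card = 5 ∧
        X3.card = 6 ∧
        Disjoint X1 X2 ∧
        Disjoint X1 X3 ∧
        Disjoint X2 X3 ∧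
        X1 ∪ X2 ∪ X3 = V ∧
        ∀ b ∈ B,
          (((if (b ∩ X1).Nonempty then 1 else 0) +
           (if (b ∩ X2).Nonempty then 1 else 0) +
           (if (b ∩ X3).Nonempty then 1 else 0) : ℕ) = 2) := by
  refine ⟨Finset.range 13, bicoloredBlocks, Finset.card_range 13, isSTS_bicoloredBlocks,
    Finset.range 2, Finset.Ico 2 7, Finset.Ico 7 13, ?_⟩
  decide +kernel
end

section
/- There exists a Steiner triple system of order 21 admitting a strict 3-bicoloring whose color classes have sizes 4, 8 and 9, that is, a partition of its 21 points into classes of sizes 4, 8 and 9 such that every block intersects exactly two of the classes. -/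
/-- The blocks of a Steiner triple system of order 21, invariant under the permutation
`(1 2 3)(4 5 6)(7 8 9)(12 13 14)(15 16 17)(18 19 20)`. -/
def blocks21 : Finset (Finset ℕ) :=
  {{0, 1, 20}, {0, 2, 18}, {0, 3, 19}, {0, 4, 9}, {0, 5, 7}, {0, 6, 8}, {0, 10, 11},
   {0, 12, 16}, {0, 13, 17}, {0, 14, 15}, {1, 2, 19}, {1, 3, 18}, {1, 4, 10}, {1, 5, 8},
   {1, 6, 11}, {1, 7, 9}, {1, 12, 14}, {1, 13, 15}, {1, 16, 17}, {2, 3, 20}, {2, 4, 11},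
   {2, 5, 10}, {2, 6, 9}, {2, 7, 8}, {2, 12, 13}, {2, 14, 16}, {2, 15, 17}, {3, 4, 7},
   {3, 5, 11}, {3, 6, 10}, {3, 8, 9}, {3, 12, 17}, {3, 13, 14}, {3, 15, 16}, {4, 5, 17},
   {4, 6, 16}, {4, 8, 15}, {4, 12, 20}, {4, 13, 19}, {4, 14, 18}, {5, 6, 15}, {5, 9, 16},
   {5, 12, 19}, {5, 13, 18}, {5, 14, 20}, {6, 7, 17}, {6, 12, 18}, {6, 13, 20}, {6, 14, 19},
   {7, 10, 12}, {7, 11, 14}, {7, 13, 16}, {7, 15, 20}, {7, 18, 19}, {8, 10, 13}, {8, 11, 12},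
   {8, 14, 17}, {8, 16, 18}, {8, 19, 20}, {9, 10, 14}, {9, 11, 13}, {9, 12, 15}, {9, 17, 19},
   {9, 18, 20}, {10, 15, 18}, {10, 16, 19}, {10, 17, 20}, {11, 15, 19}, {11, 16, 20},
   {11, 17, 18}}

theorem isSTS_blocks21 : IsSTS (Finset.range 21) blocks21 :=
  isSTS_of_card_filter_eq_one (by decide +kernel) (by decide +kernel)

theorem stmt_17 :
    ∃ (V : Finset ℕ) (B : Finset (Finset ℕ)),
      V.card = 21 ∧ IsSTS V B ∧
      ∃ X1 X2 X3 : Finset ℕ,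
        X1.card = 4 ∧
        X2.card = 8 ∧
        X3.card = 9 ∧
        Disjoint X1 X2 ∧
        Disjoint X1 X3 ∧
        Disjoint X2 X3 ∧
        X1 ∪ X2 ∪ X3 = V ∧
        ∀ b ∈ B,
          (((if (b ∩ X1).Nonempty then 1 else 0) +
           (if (b ∩ X2).Nonempty then 1 else 0) +
           (if (b ∩ X3).Nonempty then 1 else 0) : ℕ) = 2) := by
  refine ⟨Finset.range 21, blocks21, Finset.card_range 21, isSTS_blocks21,
    Finset.range 4, Finset.Ico 4 12, Finset.Ico 12 21, ?_⟩
  decide +kernel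
end

section
/- There exists a Steiner triple system of order 45 admitting a strict 4-bicoloring whose color classes have sizes 4, 6, 13 and 22, that is, a partition of its 45 points into classes of sizes 4, 6, 13 and 22 such that every block intersects exactly two of the classes. -/
/-- The triples `{x, y, f x y}` spanned by a binary operation on `{0, …, n - 1}`. -/
def triplesOfOp (n : ℕ) (f : ℕ → ℕ → ℕ) : Finset (Finset ℕ) :=
  (Finset.range n).offDiag.image fun p => {p.1, p.2, f p.1 p.2}

theorem mem_triplesOfOp {n : ℕ} {f : ℕ → ℕ → ℕ} {b : Finset ℕ} :
    b ∈ triplesOfOp n f ↔ ∃ x < n, ∃ y < n, x ≠ y ∧ b = {x, y, f x y} := by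
  simp only [triplesOfOp, Finset.mem_image, Finset.mem_offDiag, Finset.mem_range, Prod.exists]
  grind

/-- A Steiner quasigroup on `{0, …, n - 1}` gives a Steiner triple system. -/
theorem isSTS_triplesOfOp {n : ℕ} {f : ℕ → ℕ → ℕ}
    (hlt : ∀ x < n, ∀ y < n, f x y < n)
    (hidem : ∀ x < n, f x x = x)
    (hcomm : ∀ x < n, ∀ y < n, f x y = f y x)
    (hinv : ∀ x < n, ∀ y < n, f x (f x y) = y) :
    IsSTS (Finset.range n) (triplesOfOp n f) := by
  have hne : ∀ x < n, ∀ y < n, x ≠ y → f x y ≠ x ∧ f x y ≠ y := fun x hx y hy hxy =>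
    ⟨fun h => hxy (by have := hinv x hx y hy; rw [h, hidem x hx] at this; exact this),
     fun h => hxy (by
      have := hinv y hy x hx
      rw [hcomm y hy x hx, h, hidem y hy] at this
      exact this.symm)⟩
  refine ⟨fun b hb => ?_, fun x hx y hy hxy => ?_⟩
  · obtain ⟨x, hx, y, hy, hxy, rfl⟩ := mem_triplesOfOp.1 hb
    obtain ⟨h₁, h₂⟩ := hne x hx y hy hxy
    refine ⟨Finset.card_eq_three.2 ⟨x, y, f x y, hxy, h₁.symm, h₂.symm, rfl⟩, ?_⟩
    simp [Finset.insert_subset_iff, hx, hy, hlt x hx y hy]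
  · rw [Finset.mem_range] at hx hy
    refine ⟨{x, y, f x y}, ⟨mem_triplesOfOp.2 ⟨x, hx, y, hy, hxy, rfl⟩, by simp, by simp⟩, ?_⟩
    rintro b ⟨hb, hxb, hyb⟩
    obtain ⟨u, hu, v, hv, huv, rfl⟩ := mem_triplesOfOp.1 hb
    have h₁ : f v u = f u v := hcomm v hv u hu
    have h₂ : f u (f u v) = v := hinv u hu v hv
    have h₃ : f v (f u v) = u := h₁ ▸ hinv v hv u hu
    have h₄ : f (f u v) u = v := hcomm u hu _ (hlt u hu v hv) ▸ h₂
    have h₅ : f (f u v) v = u := hcomm v hv _ (hlt u hu v hv) ▸ h₃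
    simp only [Finset.mem_insert, Finset.mem_singleton] at hxb hyb
    ext a
    simp only [Finset.mem_insert, Finset.mem_singleton]
    rcases hxb with rfl | rfl | rfl <;> rcases hyb with rfl | rfl | rfl <;>
      first
      | exact absurd rfl hxy
      | (simp only [h₁, h₂, h₃, h₄, h₅] <;> tauto)

/-- Multiplication table of a Steiner quasigroup of order 45. -/
def quasigroupTable : List (List ℕ) :=
  [[0, 12, 19, 22, 9, 8, 7, 6, 5, 4, 20, 15, 1, 17, 21, 11, 18, 13, 16, 2, 10, 14, 3, 24, 23, 26, 25, 28, 27, 30, 29, 37, 39, 35, 36, 33, 34, 31, 43, 32, 42, 44, 40, 38, 41],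
   [12, 1, 23, 24, 8, 7, 9, 5, 4, 6, 22, 21, 0, 20, 19, 18, 17, 16, 15, 14, 13, 11, 10, 2, 3, 27, 28, 25, 26, 43, 44, 41, 42, 36, 35, 34, 33, 39, 40, 37, 38, 31, 32, 29, 30],
   [19, 23, 2, 25, 7, 6, 5, 4, 9, 8, 21, 22, 20, 18, 17, 16, 15, 14, 13, 0, 12, 10, 11, 1, 26, 3, 24, 29, 30, 27, 28, 38, 37, 39, 40, 36, 35, 32, 31, 33, 34, 42, 41, 44, 43],
   [22, 24, 25, 3, 6, 9, 4, 8, 7, 5, 19, 20, 21, 16, 18, 17, 13, 15, 14, 10, 11, 12, 0, 26, 1, 2, 23, 30, 29, 28, 27, 39, 40, 38, 37, 41, 44, 34, 33, 31, 32, 35, 43, 42, 36],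
   [9, 8, 7, 6, 4, 21, 3, 2, 1, 0, 18, 19, 22, 15, 16, 13, 14, 20, 10, 11, 17, 5, 12, 25, 27, 23, 29, 24, 31, 26, 43, 28, 41, 40, 44, 37, 38, 35, 36, 42, 33, 32, 39, 30, 34],
   [8, 7, 6, 9, 21, 5, 2, 1, 0, 3, 17, 18, 19, 22, 15, 14, 20, 10, 11, 12, 16, 4, 13, 27, 25, 24, 30, 23, 32, 42, 26, 43, 28, 44, 39, 38, 37, 36, 35, 34, 41, 40, 29, 31, 33],
   [7, 9, 5, 4, 3, 2, 6, 0, 22, 1, 16, 14, 18, 21, 11, 20, 10, 19, 12, 17, 15, 13, 8, 28, 29, 30, 27, 26, 23, 24, 25, 44, 43, 41, 42, 39, 40, 38, 37, 35, 36, 33, 34, 32, 31],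
   [6, 5, 4, 8, 2, 1, 0, 7, 3, 12, 15, 17, 9, 19, 20, 10, 22, 11, 21, 13, 14, 18, 16, 29, 28, 31, 32, 33, 24, 23, 37, 25, 26, 27, 41, 40, 43, 30, 42, 44, 35, 34, 38, 36, 39],
   [5, 4, 9, 7, 1, 0, 22, 3, 8, 2, 14, 16, 13, 12, 10, 21, 11, 18, 17, 20, 19, 15, 6, 30, 31, 28, 33, 32, 25, 38, 23, 24, 27, 26, 43, 42, 41, 44, 29, 40, 39, 36, 35, 34, 37],
   [4, 6, 8, 5, 0, 3, 1, 12, 2, 9, 11, 10, 7, 14, 13, 22, 19, 21, 20, 16, 18, 17, 15, 31, 30, 29, 34, 36, 38, 25, 24, 23, 44, 42, 26, 43, 27, 40, 28, 41, 37, 39, 33, 35, 32],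
   [20, 22, 21, 19, 18, 17, 16, 15, 14, 11, 10, 9, 26, 27, 8, 7, 6, 5, 4, 3, 0, 2, 1, 32, 33, 34, 12, 13, 39, 37, 38, 40, 23, 24, 25, 44, 42, 29, 30, 28, 31, 43, 36, 41, 35],
   [15, 21, 22, 20, 19, 18, 14, 17, 16, 10, 9, 11, 28, 29, 6, 0, 8, 7, 5, 4, 3, 1, 2, 33, 32, 35, 31, 34, 12, 13, 41, 26, 24, 23, 27, 25, 39, 42, 44, 36, 43, 30, 37, 40, 38],
   [1, 0, 20, 21, 22, 19, 18, 9, 13, 7, 26, 28, 12, 8, 30, 31, 32, 33, 6, 5, 2, 3, 4, 34, 35, 36, 10, 40, 11, 39, 14, 15, 16, 17, 23, 24, 25, 43, 41, 29, 27, 38, 44, 37, 42],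
   [17, 20, 18, 16, 15, 22, 21, 19, 12, 14, 27, 29, 8, 13, 9, 4, 3, 0, 2, 7, 1, 6, 5, 35, 34, 32, 44, 10, 40, 11, 42, 36, 25, 43, 24, 23, 31, 41, 39, 38, 28, 37, 30, 33, 26],
   [21, 19, 17, 18, 16, 15, 11, 20, 10, 13, 8, 6, 30, 9, 14, 5, 4, 2, 3, 1, 7, 0, 34, 36, 37, 33, 35, 31, 42, 41, 12, 27, 38, 25, 22, 26, 23, 24, 32, 43, 44, 29, 28, 39, 40],
   [11, 18, 16, 17, 13, 14, 20, 10, 21, 22, 7, 0, 31, 4, 5, 15, 2, 3, 1, 35, 6, 8, 9, 37, 36, 41, 40, 42, 43, 44, 39, 12, 33, 32, 38, 19, 24, 23, 34, 30, 26, 25, 27, 28, 29],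
   [18, 17, 15, 13, 14, 20, 10, 22, 11, 19, 6, 8, 32, 3, 4, 2, 16, 1, 0, 9, 5, 36, 7, 38, 39, 37, 41, 43, 44, 35, 40, 42, 12, 34, 33, 29, 21, 25, 23, 24, 30, 26, 31, 27, 28],
   [13, 16, 14, 15, 20, 10, 19, 11, 18, 21, 5, 7, 33, 0, 2, 3, 1, 17, 8, 6, 4, 9, 37, 39, 38, 43, 42, 44, 41, 40, 36, 34, 35, 12, 31, 32, 30, 22, 24, 23, 29, 28, 26, 25, 27],
   [16, 15, 13, 14, 10, 11, 12, 21, 17, 20, 4, 5, 6, 2, 3, 1, 0, 8, 18, 38, 9, 7, 39, 40, 42, 44, 43, 41, 37, 36, 35, 33, 34, 31, 32, 30, 29, 28, 19, 22, 23, 27, 24, 26, 25],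
   [2, 14, 0, 10, 11, 12, 17, 13, 20, 16, 3, 4, 5, 7, 1, 35, 9, 6, 38, 19, 8, 40, 41, 44, 43, 42, 39, 37, 36, 34, 33, 32, 31, 30, 29, 15, 28, 27, 18, 26, 21, 22, 25, 24, 23],
   [10, 13, 12, 11, 17, 16, 15, 14, 19, 18, 0, 3, 2, 1, 7, 6, 5, 4, 9, 8, 20, 42, 43, 41, 44, 40, 38, 39, 35, 31, 34, 29, 36, 37, 30, 28, 32, 33, 26, 27, 25, 23, 21, 22, 24],
   [14, 11, 10, 12, 5, 4, 13, 18, 15, 17, 2, 1, 3, 6, 0, 8, 36, 9, 7, 40, 42, 21, 44, 43, 41, 39, 37, 38, 34, 33, 32, 35, 30, 29, 28, 31, 16, 26, 27, 25, 19, 24, 20, 23, 22],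
   [3, 10, 11, 0, 12, 13, 8, 16, 6, 15, 1, 2, 4, 5, 34, 9, 7, 37, 39, 41, 43, 44, 22, 42, 40, 38, 36, 35, 33, 32, 31, 30, 29, 28, 14, 27, 26, 17, 25, 18, 24, 19, 23, 20, 21],
   [24, 2, 1, 26, 25, 27, 28, 29, 30, 31, 32, 33, 34, 35, 36, 37, 38, 39, 40, 44, 41, 43, 42, 23, 0, 4, 3, 5, 6, 7, 8, 9, 10, 11, 12, 13, 14, 15, 16, 17, 18, 20, 22, 21, 19],
   [23, 3, 26, 1, 27, 25, 29, 28, 31, 30, 33, 32, 35, 34, 37, 36, 39, 38, 42, 43, 44, 41, 40, 0, 24, 5, 2, 4, 7, 6, 9, 8, 11, 10, 13, 12, 15, 14, 17, 16, 22, 21, 18, 19, 20],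
   [26, 27, 3, 2, 23, 24, 30, 31, 28, 29, 34, 35, 36, 32, 33, 41, 37, 43, 44, 42, 40, 39, 38, 4, 5, 25, 0, 1, 8, 9, 6, 7, 13, 14, 10, 11, 12, 16, 22, 21, 20, 15, 19, 17, 18],
   [25, 28, 24, 23, 29, 30, 27, 32, 33, 34, 12, 31, 10, 44, 35, 40, 41, 42, 43, 39, 38, 37, 36, 3, 2, 0, 26, 6, 1, 4, 5, 11, 7, 8, 9, 14, 22, 21, 20, 19, 15, 16, 17, 18, 13],
   [28, 25, 29, 30, 24, 23, 26, 33, 32, 36, 13, 34, 40, 10, 31, 42, 43, 44, 41, 37, 39, 38, 35, 5, 4, 1, 6, 27, 0, 2, 3, 14, 8, 7, 11, 22, 9, 19, 21, 20, 12, 18, 15, 16, 17],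
   [27, 26, 30, 29, 31, 32, 23, 24, 25, 38, 39, 12, 11, 40, 42, 43, 44, 41, 37, 36, 35, 34, 33, 6, 7, 8, 1, 0, 28, 3, 2, 4, 5, 22, 21, 20, 19, 18, 9, 10, 13, 17, 14, 15, 16],
   [30, 43, 27, 28, 26, 42, 24, 23, 38, 25, 37, 13, 39, 11, 41, 44, 35, 40, 36, 34, 31, 33, 32, 7, 6, 9, 4, 2, 3, 29, 0, 20, 22, 21, 19, 16, 18, 10, 8, 12, 17, 14, 5, 1, 15],
   [29, 44, 28, 27, 43, 26, 25, 37, 23, 24, 38, 41, 14, 42, 12, 39, 40, 36, 35, 33, 34, 32, 31, 8, 9, 6, 5, 3, 2, 0, 30, 22, 21, 19, 20, 18, 17, 7, 10, 15, 16, 11, 13, 4, 1],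
   [37, 41, 38, 39, 28, 43, 44, 25, 24, 23, 40, 26, 15, 36, 27, 12, 42, 34, 33, 32, 29, 35, 30, 9, 8, 7, 11, 14, 4, 20, 22, 31, 19, 18, 17, 21, 13, 0, 2, 3, 10, 1, 16, 5, 6],
   [39, 42, 37, 40, 41, 28, 43, 26, 27, 44, 23, 24, 16, 25, 38, 33, 12, 35, 34, 31, 36, 30, 29, 10, 11, 13, 7, 8, 5, 22, 21, 19, 32, 15, 18, 17, 20, 2, 14, 0, 3, 4, 1, 6, 9],
   [35, 36, 39, 38, 40, 44, 41, 27, 26, 42, 24, 23, 17, 43, 25, 32, 34, 12, 31, 30, 37, 29, 28, 11, 10, 14, 8, 7, 22, 21, 19, 18, 15, 33, 16, 0, 1, 20, 3, 2, 4, 6, 9, 13, 5],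
   [36, 35, 40, 37, 44, 39, 42, 41, 43, 26, 25, 27, 23, 24, 22, 38, 33, 31, 32, 29, 30, 28, 14, 12, 13, 10, 9, 11, 21, 19, 20, 17, 18, 16, 34, 1, 0, 3, 15, 5, 2, 7, 6, 8, 4],
   [33, 34, 36, 41, 37, 38, 39, 40, 42, 43, 44, 25, 24, 23, 26, 19, 29, 32, 30, 15, 28, 31, 27, 13, 12, 11, 14, 22, 20, 16, 18, 21, 17, 0, 1, 35, 2, 4, 5, 6, 7, 3, 8, 9, 10],
   [34, 33, 35, 44, 38, 37, 40, 43, 41, 27, 42, 39, 25, 31, 23, 24, 21, 30, 29, 28, 32, 16, 26, 14, 15, 12, 22, 9, 19, 18, 17, 13, 20, 1, 0, 2, 36, 5, 4, 11, 6, 8, 10, 7, 3],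
   [31, 39, 32, 34, 35, 36, 38, 30, 44, 40, 29, 42, 43, 41, 24, 23, 25, 22, 28, 27, 33, 26, 17, 15, 14, 16, 21, 19, 18, 10, 7, 0, 2, 20, 3, 4, 5, 37, 6, 1, 9, 13, 11, 12, 8],
   [43, 40, 31, 33, 36, 35, 37, 42, 29, 28, 30, 44, 41, 39, 32, 34, 23, 24, 19, 18, 26, 27, 25, 16, 17, 22, 20, 21, 9, 8, 10, 2, 14, 3, 15, 5, 4, 6, 38, 13, 1, 12, 7, 0, 11],
   [32, 37, 33, 31, 42, 34, 35, 44, 40, 41, 28, 36, 29, 38, 43, 30, 24, 23, 22, 26, 27, 25, 18, 17, 16, 21, 19, 20, 10, 12, 15, 3, 0, 2, 5, 6, 11, 1, 13, 39, 8, 9, 4, 14, 7],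
   [42, 38, 34, 32, 33, 41, 36, 35, 39, 37, 31, 43, 27, 28, 44, 26, 30, 29, 23, 21, 25, 19, 24, 18, 22, 20, 15, 12, 13, 17, 16, 10, 3, 4, 2, 7, 6, 9, 1, 8, 40, 5, 0, 11, 14],
   [44, 31, 42, 35, 32, 40, 33, 34, 36, 39, 43, 30, 38, 37, 29, 25, 26, 28, 27, 22, 23, 24, 19, 20, 21, 15, 16, 18, 17, 14, 11, 1, 4, 6, 7, 3, 8, 13, 12, 9, 5, 41, 2, 10, 0],
   [40, 32, 41, 43, 39, 29, 34, 38, 35, 33, 36, 37, 44, 30, 28, 27, 31, 26, 24, 25, 21, 20, 23, 22, 18, 19, 17, 15, 14, 5, 13, 16, 1, 9, 6, 8, 10, 11, 7, 4, 0, 2, 42, 3, 12],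
   [38, 29, 44, 42, 30, 31, 32, 36, 34, 35, 41, 40, 37, 33, 39, 28, 27, 25, 26, 24, 22, 23, 20, 21, 19, 17, 18, 16, 15, 1, 4, 5, 6, 13, 8, 9, 7, 12, 0, 14, 11, 10, 3, 43, 2],
   [41, 30, 43, 36, 34, 33, 31, 39, 37, 32, 35, 38, 42, 26, 40, 29, 28, 27, 25, 23, 24, 22, 21, 19, 20, 18, 13, 17, 16, 15, 1, 6, 9, 5, 4, 10, 3, 8, 11, 7, 14, 0, 12, 2, 44]]

/-- The Steiner quasigroup operation read off from `quasigroupTable`. -/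
def quasigroupOp (x y : ℕ) : ℕ := (quasigroupTable.getD x []).getD y 0

theorem triple_inter_Ico_nonempty (x y z a b : ℕ) :
    (({x, y, z} : Finset ℕ) ∩ Finset.Ico a b).Nonempty ↔
      (a ≤ x ∧ x < b) ∨ (a ≤ y ∧ y < b) ∨ (a ≤ z ∧ z < b) := by
  simp [Finset.Nonempty, or_and_right, exists_or]

theorem stmt_18 :
    ∃ (V : Finset ℕ) (B : Finset (Finset ℕ)),
      V.card = 45 ∧ IsSTS V B ∧
      ∃ X1 X2 X3 X4 : Finset ℕ,
        X1.card = 4 ∧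
        X2.card = 6 ∧
        X3.card = 13 ∧
        X4.card = 22 ∧
        Disjoint X1 X2 ∧
        Disjoint X1 X3 ∧
        Disjoint X1 X4 ∧
        Disjoint X2 X3 ∧
        Disjoint X2 X4 ∧
        Disjoint X3 X4 ∧
        X1 ∪ X2 ∪ X3 ∪ X4 = V ∧
        ∀ b ∈ B,
          (((if (b ∩ X1).Nonempty then 1 else 0) +
           (if (b ∩ X2).Nonempty then 1 else 0) +
           (if (b ∩ X3).Nonempty then 1 else 0) +
           (if (b ∩ X4).Nonempty then 1 else 0) : ℕ) = 2) := by
  refine ⟨Finset.range 45, triplesOfOp 45 quasigroupOp, by simp,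
    isSTS_triplesOfOp (by decide +kernel) (by decide +kernel) (by decide +kernel)
      (by decide +kernel),
    Finset.Ico 0 4, Finset.Ico 4 10, Finset.Ico 10 23, Finset.Ico 23 45, by simp, by simp,
    by simp, by simp, by decide, by decide, by decide, by decide, by decide, by decide,
    by decide, fun b hb => ?_⟩
  obtain ⟨x, hx, y, hy, hxy, rfl⟩ := mem_triplesOfOp.1 hb
  simp only [triple_inter_Ico_nonempty]
  revert x y
  have key : ∀ x < 45, ∀ y < 45, x ≠ y →
      (((if (0 ≤ x ∧ x < 4) ∨ (0 ≤ y ∧ y < 4) ∨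
          (0 ≤ quasigroupOp x y ∧ quasigroupOp x y < 4) then 1 else 0) +
        (if (4 ≤ x ∧ x < 10) ∨ (4 ≤ y ∧ y < 10) ∨
          (4 ≤ quasigroupOp x y ∧ quasigroupOp x y < 10) then 1 else 0) +
        (if (10 ≤ x ∧ x < 23) ∨ (10 ≤ y ∧ y < 23) ∨
          (10 ≤ quasigroupOp x y ∧ quasigroupOp x y < 23) then 1 else 0) +
        (if (23 ≤ x ∧ x < 45) ∨ (23 ≤ y ∧ y < 45) ∨
          (23 ≤ quasigroupOp x y ∧ quasigroupOp x y < 45) then 1 else 0) : ℕ) = 2) := by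
    decide +kernel
  intro x hx y hy hxy _
  exact key x hx y hy hxy
end
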